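/- Let K be a field, a ∈ K, m ≥ 1 an integer, and let C_n = \binom{2n}{n}/(n+1) be the Catalan numbers. Define the sequence f^{(m)}_n in K by f^{(m)}_n = a^k C_k if n = mk for some integer k ≥ 0, and f^{(m)}_n = 0 otherwise (so ∑ f^{(m)}_n x^n = ∑_k a^k C_k x^{mk}). Then for every n ≥ 1: det(f^{(m)}_{i+j})_{i,j=0}^{mn−1} = (−1)^{n\binom{m−1}{2}} a^{n(mn−1)} and det(f^{(m)}_{i+j})_{i,j=0}^{mn} = (−1)^{n\binom{m−1}{2}} a^{n(mn+1)}, while det(f^{(m)}_{i+j})_{i,j=0}^{N} = 0 for every N > 0 that is not of the form mn−1 or mn; moreover det(f^{(m)}_{i+j+1})_{i,j=0}^{m−1} = (−1)^{\binom{m}{2}} a^{m}. -/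

import Mathlib

/-- Ballot-type triangle: `T (n+1) k = T n (k-1) + T n (k+1)`. -/
def balT : ℕ → ℕ → ℕ
  | 0, 0 => 1
  | 0, _ + 1 => 0
  | n + 1, 0 => balT n 1
  | n + 1, k + 1 => balT n k + balT n (k + 2)

lemma balT_succ_zero (n : ℕ) : balT (n + 1) 0 = balT n 1 := by rw [balT]

lemma balT_succ_succ (n k : ℕ) : balT (n + 1) (k + 1) = balT n k + balT n (k + 2) := by
  rw [balT]

lemma balT_gt : ∀ (n k : ℕ), n < k → balT n k = 0 := by
  intro n
  induction n with
  | zero =>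
    intro k hk
    obtain ⟨k, rfl⟩ := Nat.exists_eq_succ_of_ne_zero (by omega : k ≠ 0)
    simp [balT]
  | succ n ih =>
    intro k hk
    obtain ⟨k, rfl⟩ := Nat.exists_eq_succ_of_ne_zero (by omega : k ≠ 0)
    rw [Nat.succ_eq_add_one, balT_succ_succ, ih k (by omega), ih (k + 2) (by omega)]

lemma balT_self (n : ℕ) : balT n n = 1 := by
  induction n with
  | zero => simp [balT]
  | succ n ih => rw [balT_succ_succ, ih, balT_gt _ _ (by omega)]

lemma balT_odd : ∀ (n k : ℕ), (n + k) % 2 = 1 → balT n k = 0 := by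
  intro n
  induction n with
  | zero =>
    intro k hk
    exact balT_gt _ _ (by omega)
  | succ n ih =>
    intro k hk
    rcases k with _ | k
    · rw [balT_succ_zero, ih 1 (by omega)]
    · rw [balT_succ_succ, ih k (by omega), ih (k + 2) (by omega)]

lemma balT_choose : ∀ (n k l : ℕ), n = k + 2 * l + 2 →
    balT n k + n.choose l = n.choose (l + 1) := by
  intro n
  induction n with
  | zero => intro k l h; omega
  | succ n ih =>
    intro k l h
    rcases k with _ | k
    · rw [balT_succ_zero]
      rcases l with _ | l
      · obtain rfl : n = 1 := by omega
        rw [balT_self]; simp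
      · have h1 := ih 1 l (by omega)
        have h2 : n.choose (l + 1) = n.choose (l + 1 + 1) :=
          Nat.choose_symm_of_eq_add (by omega)
        rw [Nat.choose_succ_succ' n l, Nat.choose_succ_succ' n (l + 1)]
        omega
    · rw [balT_succ_succ]
      have h1 := ih k l (by omega)
      rcases l with _ | l
      · obtain rfl : n = k + 2 := by omega
        rw [balT_self]
        simp at h1 ⊢
        omega
      · have h2 := ih (k + 2) l (by omega)
        rw [Nat.choose_succ_succ' n l, Nat.choose_succ_succ' n (l + 1)]
        omega

lemma balT_catalan (n : ℕ) : balT (2 * n) 0 = catalan n := by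
  rcases n with _ | n
  · simp [balT]
  · have h1 := balT_choose (2 * (n + 1)) 0 n (by omega)
    have h2 := succ_mul_catalan_eq_centralBinom (n + 1)
    rw [Nat.centralBinom_eq_two_mul_choose] at h2
    have h3 := Nat.choose_succ_right_eq (2 * (n + 1)) n
    rw [show 2 * (n + 1) - n = n + 2 by omega] at h3
    have h4 : (n + 2) * balT (2 * (n + 1)) 0 = (n + 2) * catalan (n + 1) := by
      zify at *
      linear_combination (n + 2 : ℤ) * h1 - h2 + h3
    exact Nat.eq_of_mul_eq_mul_left (by omega) h4

lemma balT_shift (i j L : ℕ) :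
    ∑ k ∈ Finset.range (L + 1), balT (i + 1) k * balT j k + balT i L * balT j (L + 1) =
    ∑ k ∈ Finset.range (L + 1), balT i k * balT (j + 1) k + balT i (L + 1) * balT j L := by
  induction L with
  | zero => simp [balT_succ_zero]; ring
  | succ L ih =>
    rw [Finset.sum_range_succ, Finset.sum_range_succ _ (L + 1), balT_succ_succ, balT_succ_succ]
    zify at *
    linear_combination ih

lemma balT_sum (i : ℕ) : ∀ (j L : ℕ), i + j ≤ L →
    ∑ k ∈ Finset.range (L + 1), balT i k * balT j k = balT (i + j) 0 := by
  induction i with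
  | zero =>
    intro j L h
    rw [Finset.sum_range_succ', Finset.sum_eq_zero]
    · simp [balT]
    · intro k _; simp [balT]
  | succ i ih =>
    intro j L h
    have h1 := balT_shift i j L
    rw [balT_gt j (L + 1) (by omega), balT_gt i (L + 1) (by omega), ih (j + 1) L (by omega)] at h1
    simp at h1
    rw [h1]; congr 1; omega

lemma sum_range_two_mul (g : ℕ → ℕ) (L : ℕ) :
    ∑ k ∈ Finset.range (2 * L), g k = ∑ k ∈ Finset.range L, (g (2 * k) + g (2 * k + 1)) := by
  induction L with
  | zero => simp
  | succ L ih =>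
    rw [show 2 * (L + 1) = 2 * L + 1 + 1 by ring, Finset.sum_range_succ, Finset.sum_range_succ,
      Finset.sum_range_succ, ih]; ring

lemma balT_core (e p q : ℕ) (he : e = 0 ∨ e = 1) :
    ∑ k ∈ Finset.range (p + 1), balT (2 * p + e) (2 * k + e) * balT (2 * q + e) (2 * k + e)
      = catalan (p + q + e) := by
  rw [← balT_catalan]
  have h := balT_sum (2 * p + e) (2 * q + e) (2 * (p + q + 2) - 1) (by omega)
  rw [show 2 * (p + q + 2) - 1 + 1 = 2 * (p + q + 2) by omega, sum_range_two_mul] at h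
  rw [show 2 * (p + q + e) = 2 * p + e + (2 * q + e) by ring, ← h]
  have hs : Finset.range (p + 1) ⊆ Finset.range (p + q + 2) := by
    intro x; simp; omega
  rw [Finset.sum_subset hs]
  · apply Finset.sum_congr rfl
    intro k _
    rcases he with rfl | rfl
    · rw [balT_odd (2 * p + 0) (2 * k + 1) (by omega)]; simp
    · rw [balT_odd (2 * p + 1) (2 * k) (by omega)]; simp
  · intro x _ hx
    simp at hx
    rw [balT_gt _ _ (by omega)]; simp

/-- 0 or 1 according to the residue. -/
def resE (m i : ℕ) : ℕ := if i % m = 0 then 0 else 1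

/-- lower unitriangular factor -/
def facA {K : Type*} [Field K] (a : K) (m : ℕ) (i j : ℕ) : K :=
  if i % m = j % m then
    a ^ (i / m - j / m) * (balT (2 * (i / m) + resE m i) (2 * (j / m) + resE m i) : K) else 0

/-- monomial middle factor -/
def facQ {K : Type*} [Field K] (a : K) (m : ℕ) (i j : ℕ) : K :=
  if i / m = j / m ∧ m ∣ i + j then a ^ (2 * (i / m) + resE m i) else 0

lemma facA_self {K : Type*} [Field K] (a : K) (m i : ℕ) : facA a m i i = 1 := by
  simp [facA, balT_self]

lemma facA_gt {K : Type*} [Field K] (a : K) (m i j : ℕ) (h : i < j) :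
    facA a m i j = 0 := by
  unfold facA
  split_ifs with h1
  · have h2 : i / m ≤ j / m := Nat.div_le_div_right h.le
    have h3 : i / m ≠ j / m := by
      intro h3
      have e1 := Nat.div_add_mod i m
      have e2 := Nat.div_add_mod j m
      rw [h1, h3] at e1
      omega
    rw [balT_gt _ _ (by omega)]; simp
  · rfl

lemma facA_sum {K : Type*} [Field K] (a : K) (m : ℕ) (hm : 1 ≤ m) (N i : ℕ) (hi : i < N)
    (g : ℕ → K) :
    ∑ x ∈ Finset.range N, facA a m i x * g x =
      ∑ k ∈ Finset.range (i / m + 1), a ^ (i / m - k) *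
        (balT (2 * (i / m) + resE m i) (2 * k + resE m i) : K) * g (m * k + i % m) := by
  have hr : i % m < m := Nat.mod_lt _ hm
  have hd : ∀ k, (m * k + i % m) / m = k := by
    intro k
    rw [Nat.mul_add_div (by omega), Nat.div_eq_of_lt hr]; simp
  symm
  have hinj : Set.InjOn (fun k => m * k + i % m) (Finset.range (i / m + 1) : Set ℕ) := by
    intro x _ y _ h
    have := congrArg (· / m) h
    simpa [hd] using this
  have hsub : (Finset.range (i / m + 1)).image (fun k => m * k + i % m) ⊆ Finset.range N := by
    intro x hx
    simp only [Finset.mem_image, Finset.mem_range] at hx ⊢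
    obtain ⟨k, hk, rfl⟩ := hx
    have := Nat.mul_le_mul_left m (by omega : k ≤ i / m)
    have := Nat.div_add_mod i m
    omega
  rw [← Finset.sum_subset hsub, Finset.sum_image hinj]
  · apply Finset.sum_congr rfl
    intro k _
    simp [facA, hd]
  · intro x _ hx
    unfold facA
    split_ifs with h
    · have : i / m < x / m := by
        by_contra hc
        apply hx
        simp only [Finset.mem_image, Finset.mem_range]
        exact ⟨x / m, by omega, by rw [h]; exact Nat.div_add_mod x m⟩
      rw [balT_gt _ _ (by omega)]; simp
    · simp

lemma resE_eq (m i j : ℕ) (hd : m ∣ i + j) : resE m i = resE m j := by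
  unfold resE
  have h : m ∣ i ↔ m ∣ j := ⟨fun h => (Nat.dvd_add_right h).1 hd, fun h => (Nat.dvd_add_left h).1 hd⟩
  simp only [← Nat.dvd_iff_mod_eq_zero, h]

lemma div_add_resE (m i j : ℕ) (hm : 1 ≤ m) (hd : m ∣ i + j) :
    (i + j) / m = i / m + j / m + resE m i := by
  have e1 := Nat.div_add_mod i m
  have e2 := Nat.div_add_mod j m
  have r1 : i % m < m := Nat.mod_lt _ hm
  have r2 : j % m < m := Nat.mod_lt _ hm
  have hE := resE_eq m i j hd
  have h1 : i + j = m * (i / m + j / m) + (i % m + j % m) := by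
    rw [mul_add]; omega
  have h2 : m ∣ i % m + j % m := by
    rw [h1] at hd
    exact (Nat.dvd_add_right (Dvd.intro _ rfl)).1 hd
  have h3 : i % m + j % m = m * resE m i := by
    obtain ⟨c, hc⟩ := h2
    by_cases h0 : i % m = 0
    · have : j % m = 0 := by
        by_contra hj
        simp [resE, h0, hj] at hE
      simp [resE, h0, this]
    · simp only [resE, h0, if_false]
      have : c < 2 := by
        by_contra hc2
        have := Nat.mul_le_mul_left m (by omega : 2 ≤ c)
        omega
      interval_cases c
      · omega
      · omega
  rw [h1, h3, ← mul_add, Nat.mul_div_cancel_left _ (by omega)]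

lemma fac_eq {K : Type*} [Field K] (a : K) (m : ℕ) (hm : 1 ≤ m) (N i j : ℕ)
    (hi : i < N) (hj : j < N) :
    ∑ x ∈ Finset.range N, facA a m i x * ∑ y ∈ Finset.range N, facA a m j y * facQ a m x y
      = if m ∣ i + j then a ^ ((i + j) / m) * (catalan ((i + j) / m) : K) else 0 := by
  rw [facA_sum a m hm N i hi]
  have hr : i % m < m := Nat.mod_lt _ hm
  have hr2 : j % m < m := Nat.mod_lt _ hm
  have hd : ∀ k r, r < m → (m * k + r) / m = k := by
    intro k r hr
    rw [Nat.mul_add_div (by omega), Nat.div_eq_of_lt hr]; simp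
  have hdv : ∀ k l, m ∣ m * k + i % m + (m * l + j % m) ↔ m ∣ i + j := by
    intro k l
    rw [Nat.dvd_iff_mod_eq_zero, Nat.dvd_iff_mod_eq_zero]
    simp [Nat.add_mod]
  have hE : ∀ k, resE m (m * k + i % m) = resE m i := by
    intro k; simp [resE]
  simp only [facA_sum a m hm N j hj]
  by_cases hdd : m ∣ i + j
  · simp only [hdd, if_true]
    rw [div_add_resE m i j hm hdd]
    have he : resE m i = 0 ∨ resE m i = 1 := by unfold resE; split_ifs <;> simp
    rw [← balT_core (resE m i) (i / m) (j / m) he]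
    push_cast
    rw [Finset.mul_sum]
    apply Finset.sum_congr rfl
    intro k hk
    simp only [Finset.mem_range] at hk
    simp only [facQ, hd _ _ hr, hd _ _ hr2, hdv, hdd, and_true, hE, mul_ite, mul_zero,
      Finset.sum_ite_eq, Finset.mem_range, ← resE_eq m i j hdd]
    split_ifs with hkj
    · have : a ^ (i / m + j / m + resE m i) =
          a ^ (i / m - k) * a ^ (j / m - k) * a ^ (2 * k + resE m i) := by
        rw [← pow_add, ← pow_add]; congr 1; omega
      rw [this]; ring
    · rw [balT_gt (2 * (j / m) + resE m i) _ (by omega)]; simp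
  · simp [facQ, hdv, hdd]

lemma det_eq_facQ {K : Type*} [Field K] (a : K) (m : ℕ) (hm : 1 ≤ m) (f : ℕ → K)
    (hf : ∀ n : ℕ, f n = if m ∣ n then a ^ (n / m) * (catalan (n / m) : K) else 0) (N : ℕ) :
    Matrix.det (Matrix.of fun i j : Fin N => f ((i : ℕ) + (j : ℕ))) =
    Matrix.det (Matrix.of fun i j : Fin N => facQ a m i j) := by
  have hA : Matrix.det (Matrix.of fun i j : Fin N => facA a m i j) = 1 := by
    rw [Matrix.det_of_isLowerTriangular]
    · simp [facA_self]
    · intro i j h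
      exact facA_gt _ _ _ _ h
  have : (Matrix.of fun i j : Fin N => f ((i : ℕ) + (j : ℕ))) =
      (Matrix.of fun i j : Fin N => facA a m i j) *
      ((Matrix.of fun i j : Fin N => facQ a m i j) *
       (Matrix.of fun i j : Fin N => facA a m i j).transpose) := by
    ext i j
    simp only [Matrix.of_apply, Matrix.mul_apply, Matrix.transpose_apply]
    rw [hf, ← fac_eq a m hm N i j i.2 j.2, Finset.sum_range]
    apply Finset.sum_congr rfl
    intro x _
    rw [Finset.sum_range]
    congr 1
    apply Finset.sum_congr rfl
    intro y _
    ring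
  rw [this, Matrix.det_mul, Matrix.det_mul, Matrix.det_transpose, hA]; simp

lemma det_antidiag {K : Type*} [Field K] (c : K) (n : ℕ) :
    Matrix.det (Matrix.of fun i j : Fin n => if (i : ℕ) + j + 1 = n then c else 0) =
      (-1) ^ n.choose 2 * c ^ n := by
  induction n with
  | zero => simp
  | succ n ih =>
    rw [Matrix.det_succ_row_zero, Finset.sum_eq_single (Fin.last n)]
    · have : ((Matrix.of fun i j : Fin (n + 1) => if (i : ℕ) + j + 1 = n + 1 then c else 0).submatrix
          Fin.succ (Fin.last n).succAbove) =
          Matrix.of fun i j : Fin n => if (i : ℕ) + j + 1 = n then c else 0 := by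
        ext i j
        simp only [Matrix.submatrix_apply, Matrix.of_apply, Fin.val_succ, Fin.succAbove_last,
          Fin.val_castSucc]
        congr 1
        rw [eq_iff_iff]; omega
      rw [this, ih, Nat.choose_succ_succ' n 1]
      simp
      ring
    · intro j _ hj
      have : (j : ℕ) ≠ n := by
        intro h; apply hj; ext; simpa using h
      simp [this]
    · simp

lemma det_facQ_m {K : Type*} [Field K] (a : K) (m : ℕ) (hm : 1 ≤ m) :
    Matrix.det (Matrix.of fun i j : Fin m => facQ a m i j) =
      (-1) ^ (m - 1).choose 2 * a ^ (m - 1) := by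
  obtain ⟨n, rfl⟩ := Nat.exists_eq_add_of_le' hm
  rw [Matrix.det_succ_row_zero, Finset.sum_eq_single 0]
  · have : ((Matrix.of fun i j : Fin (n + 1) => facQ a (n + 1) i j).submatrix
          Fin.succ (Fin.succAbove 0)) =
          Matrix.of fun i j : Fin n => if (i : ℕ) + j + 1 = n then a else 0 := by
      ext i j
      have hi := i.2
      have hj := j.2
      simp only [Matrix.submatrix_apply, Matrix.of_apply, Fin.val_succ, Fin.succAbove_zero, facQ]
      have hE : resE (n + 1) ((i : ℕ) + 1) = 1 := by
        unfold resE
        have hmod : ((i : ℕ) + 1) % (n + 1) = i + 1 := Nat.mod_eq_of_lt (by omega)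
        simp [hmod]
      rw [Nat.div_eq_of_lt (by omega), Nat.div_eq_of_lt (by omega), hE]
      simp only [true_and]
      have : (n + 1 ∣ (i : ℕ) + 1 + (j + 1)) ↔ (i : ℕ) + j + 1 = n := by
        constructor
        · rintro ⟨c, hc⟩
          have : c < 2 := by
            by_contra hc2
            have := Nat.mul_le_mul_left (n + 1) (by omega : 2 ≤ c)
            omega
          interval_cases c <;> omega
        · intro h; exact ⟨1, by omega⟩
      simp [this]
    rw [this, det_antidiag]
    simp [facQ, resE]
  · intro j _ hj
    have : ¬ (n + 1 ∣ (j : ℕ)) := by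
      intro h
      have := Nat.eq_zero_of_dvd_of_lt h j.2
      apply hj; ext; simpa using this
    simp [facQ, this]
  · simp

lemma det_facQ_add {K : Type*} [Field K] (a : K) (m : ℕ) (hm : 1 ≤ m) (N : ℕ) :
    Matrix.det (Matrix.of fun i j : Fin (m + N) => facQ a m i j) =
      (-1) ^ (m - 1).choose 2 * a ^ (m - 1) * (a ^ (2 * N) *
        Matrix.det (Matrix.of fun i j : Fin N => facQ a m i j)) := by
  rw [← Matrix.det_submatrix_equiv_self finSumFinEquiv]
  have : (Matrix.of fun i j : Fin (m + N) => facQ a m i j).submatrix finSumFinEquiv finSumFinEquiv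
      = Matrix.fromBlocks (Matrix.of fun i j : Fin m => facQ a m i j) 0 0
        (a ^ 2 • Matrix.of fun i j : Fin N => facQ a m i j) := by
    have hx : ∀ x, (m + x) / m = x / m + 1 := by
      intro x; rw [Nat.add_div_left _ (by omega)]
    ext i j
    rcases i with i | i <;> rcases j with j | j
    · simp
    · simp [facQ, hx, Nat.div_eq_of_lt i.2]
    · simp [facQ, hx, Nat.div_eq_of_lt j.2]
    · have : m ∣ m + (i : ℕ) + (m + j) ↔ m ∣ (i : ℕ) + j := by
        rw [show m + (i : ℕ) + (m + j) = m * 2 + (i + j) by ring]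
        exact (Nat.dvd_add_iff_right (Dvd.intro _ rfl)).symm
      simp only [Matrix.submatrix_apply, Matrix.of_apply, finSumFinEquiv_apply_right,
        Matrix.fromBlocks_apply₂₂, Matrix.smul_apply, Fin.val_natAdd, facQ, hx, this, smul_eq_mul,
        resE, Nat.add_mod_left, Nat.add_right_cancel_iff, mul_ite, mul_zero]
      split_ifs <;> ring
  rw [this, Matrix.det_fromBlocks_zero₂₁, det_facQ_m a m hm, Matrix.det_smul, Fintype.card_fin,
    pow_mul]


/-- Hankel determinants of the `m`-fold aerated sequence `f^{(m)}` of `aⁿCₙ` (Catalan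
numbers): `det(f^{(m)}_{i+j})_{i,j=0}^{mn−1} = (−1)^{nC(m−1,2)} a^{n(mn−1)}`,
`det(f^{(m)}_{i+j})_{i,j=0}^{mn} = (−1)^{nC(m−1,2)} a^{n(mn+1)}`, all other Hankel
determinants of positive order vanish, and
`det(f^{(m)}_{i+j+1})_{i,j=0}^{m−1} = (−1)^{C(m,2)} a^m`. -/
theorem hankel_det_aerated_catalan {K : Type*} [Field K] (a : K) (m : ℕ) (hm : 1 ≤ m)
    (f : ℕ → K)
    (hf : ∀ n : ℕ, f n = if m ∣ n then a ^ (n / m) * (catalan (n / m) : K) else 0) :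
    (∀ n : ℕ, 1 ≤ n →
      Matrix.det (Matrix.of fun i j : Fin (m * n) =>
          f ((i : ℕ) + (j : ℕ))) =
        (-1) ^ (n * Nat.choose (m - 1) 2) * a ^ (n * (m * n - 1)) ∧
      Matrix.det (Matrix.of fun i j : Fin (m * n + 1) =>
          f ((i : ℕ) + (j : ℕ))) =
        (-1) ^ (n * Nat.choose (m - 1) 2) * a ^ (n * (m * n + 1))) ∧
    (∀ N : ℕ, 0 < N → (∀ n : ℕ, 1 ≤ n → N ≠ m * n - 1 ∧ N ≠ m * n) →
      Matrix.det (Matrix.of fun i j : Fin (N + 1) =>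
        f ((i : ℕ) + (j : ℕ))) = 0) ∧
    Matrix.det (Matrix.of fun i j : Fin m => f ((i : ℕ) + (j : ℕ) + 1)) =
      (-1) ^ Nat.choose m 2 * a ^ m := by
  have hD := det_eq_facQ a m hm f hf
  have hshift : ∀ n s, Matrix.det (Matrix.of fun i j : Fin s => facQ a m i j) = 0 →
      Matrix.det (Matrix.of fun i j : Fin (m * n + s) => facQ a m i j) = 0 := by
    intro n s h
    induction n with
    | zero => rw [mul_zero, zero_add]; exact h
    | succ n ih =>
      rw [show m * (n + 1) + s = m + (m * n + s) by ring, det_facQ_add a m hm, ih]; simp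
  refine ⟨?_, ?_, ?_⟩
  · intro n hn
    rw [hD, hD]
    clear hn
    constructor
    · induction n with
      | zero => simp
      | succ n ih =>
        rw [show m * (n + 1) = m + m * n by ring, det_facQ_add a m hm, ih]
        have : (n + 1) * (m + m * n - 1) = (m - 1) + 2 * (m * n) + n * (m * n - 1) := by
          rcases n with _ | n
          · simp
          · have : 1 ≤ m * (n + 1) := Nat.mul_pos hm (by omega)
            zify [hm, this, (by omega : 1 ≤ m + m * (n + 1))]
            ring
        rw [this, add_mul, pow_add, pow_add, pow_add]
        ring
    · induction n with
      | zero => simp [facQ, resE]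
      | succ n ih =>
        rw [show m * (n + 1) + 1 = m + (m * n + 1) by ring, det_facQ_add a m hm, ih]
        have : (n + 1) * (m + (m * n + 1)) =
            (m - 1) + 2 * (m * n + 1) + n * (m * n + 1) := by
          zify [hm]
          ring
        rw [this, add_mul, pow_add, pow_add, pow_add]
        ring
  · intro N hN h
    rw [hD]
    have e := Nat.div_add_mod (N + 1) m
    have hlt : (N + 1) % m < m := Nat.mod_lt _ hm
    have h2 : 2 ≤ (N + 1) % m := by
      by_contra hc
      rcases Nat.eq_zero_or_pos ((N + 1) / m) with h0 | h0
      · rw [h0] at e; omega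
      · have := h _ h0
        omega
    rw [← e]
    apply hshift
    apply Matrix.det_eq_zero_of_row_eq_zero ⟨1, h2⟩
    intro j
    have hj := j.2
    have : ¬ (m ∣ 1 + (j : ℕ)) := by
      intro hd
      have := Nat.le_of_dvd (by omega) hd
      omega
    simp [facQ, this]
  · rw [← det_antidiag]
    congr 1
    ext i j
    have hi := i.2
    have hj := j.2
    simp only [Matrix.of_apply, hf]
    have : (m ∣ (i : ℕ) + j + 1) ↔ (i : ℕ) + j + 1 = m := by
      constructor
      · rintro ⟨c, hc⟩
        have : c < 2 := by
          by_contra hc2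
          have := Nat.mul_le_mul_left m (by omega : 2 ≤ c)
          omega
        interval_cases c <;> omega
      · intro h; rw [h]
    simp only [this]
    split_ifs with h
    · rw [h, Nat.div_self (by omega)]; simp
    · rfl
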